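/- arXiv:1306.4872 — 2 statements merged into one kernel-verified Lean document; each statement's English description precedes it below -/
import Mathlib

section
/- Let A < B and let Ψ₀,…,Ψ_{k−1}, Ω : [A,B] → ℝ be continuous functions such that both {Ψ₀,…,Ψ_{k−1}} and {Ψ₀,…,Ψ_{k−1}, Ω} are Chebyshev systems on [A,B]. Fix c⁰ = (c⁰₀,…,c⁰_{k−1}) ∈ ℝ^k and suppose the feasible set S = { σ : σ is a finite nonnegative Borel measure on [A,B] with ∫_A^B Ψ_i dσ = c⁰_i for all i = 0,…,k−1 } is nonempty. Then there exists a unique measure σ⁺ ∈ S with ∫_A^B Ω dσ⁺ = sup_{σ∈S} ∫_A^B Ω dσ, and there exists a unique measure σ⁻ ∈ S with ∫_A^B Ω dσ⁻ = inf_{σ∈S} ∫_A^B Ω dσ. -/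
open MeasureTheory Set

/-- A family of functions `Ψ₀, …, Ψ_{k-1}` is a Chebyshev system on `[A,B]` if for all
points `A ≤ x₀ < x₁ < ⋯ < x_{k-1} ≤ B` the matrix `(Ψ i (x j))` has positive determinant. -/
def IsChebyshevSystem (A B : ℝ) {k : ℕ} (Ψ : Fin k → ℝ → ℝ) : Prop :=
  ∀ x : Fin k → ℝ, StrictMono x → (∀ j, x j ∈ Set.Icc A B) →
    0 < (Matrix.of fun i j : Fin k => Ψ i (x j)).det

/-- `σ` belongs to the feasible set `S`: it is a finite nonnegative Borel measure
living on `[A,B]` whose moments with respect to `Ψ₀,…,Ψ_{k-1}` are `c₀,…,c_{k-1}`. -/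
def IsFeasible (A B : ℝ) {k : ℕ} (Ψ : Fin k → ℝ → ℝ) (c : Fin k → ℝ)
    (σ : Measure ℝ) : Prop :=
  IsFiniteMeasure σ ∧ σ (Set.Icc A B)ᶜ = 0 ∧ ∀ i, ∫ x, Ψ i x ∂σ = c i

open Module

theorem exists_sum_smul_of_mem_convexHull {E : Type*} [AddCommGroup E] [Module ℝ E]
    [FiniteDimensional ℝ E] {s : Set E} {x : E} (hx : x ∈ convexHull ℝ s) :
    ∃ (z : Fin (finrank ℝ E + 1) → E) (w : Fin (finrank ℝ E + 1) → ℝ),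
      (∀ j, z j ∈ s) ∧ w ∈ stdSimplex ℝ (Fin (finrank ℝ E + 1)) ∧ ∑ j, w j • z j = x := by
  obtain ⟨ι, _, z, w, hz, hind, hw, hw1, hx⟩ := eq_pos_convex_span_of_mem_convexHull hx
  have hcard : Fintype.card ι ≤ Fintype.card (Fin (finrank ℝ E + 1)) := by
    simpa using hind.card_le_finrank_succ.trans
      (Nat.add_le_add_right (Submodule.finrank_le _) 1)
  obtain ⟨e⟩ := Function.Embedding.nonempty_of_card_le hcard
  have : Nonempty ι := by
    by_contra h
    rw [not_nonempty_iff] at h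
    simp at hw1
  obtain ⟨i₀⟩ := this
  refine ⟨Function.extend e z fun _ => z i₀, Function.extend e w 0, fun j => ?_,
    ⟨fun j => ?_, ?_⟩, ?_⟩
  · by_cases hj : ∃ i, e i = j
    · obtain ⟨i, rfl⟩ := hj
      rw [e.injective.extend_apply]
      exact hz ⟨i, rfl⟩
    · rw [Function.extend_apply' _ _ _ hj]
      exact hz ⟨i₀, rfl⟩
  · by_cases hj : ∃ i, e i = j
    · obtain ⟨i, rfl⟩ := hj
      rw [e.injective.extend_apply]
      exact (hw i).le
    · rw [Function.extend_apply' _ _ _ hj]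
      rfl
  · rw [← hw1]
    refine (Fintype.sum_of_injective e e.injective _ _ (fun j hj => ?_) fun i => ?_).symm
    · rw [Function.extend_apply' _ _ _ hj]; rfl
    · rw [e.injective.extend_apply]
  · rw [← hx]
    refine (Fintype.sum_of_injective e e.injective _ _ (fun j hj => ?_) fun i => ?_).symm
    · rw [Function.extend_apply' w _ _ hj]; simp
    · simp [e.injective.extend_apply]

theorem IsCompact.convexHull_of_finiteDimensional {E : Type*} [NormedAddCommGroup E]
    [NormedSpace ℝ E] [FiniteDimensional ℝ E] {s : Set E} (hs : IsCompact s) :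
    IsCompact (convexHull ℝ s) := by
  have hcpt := ((isCompact_univ_pi fun _ : Fin (finrank ℝ E + 1) => hs).prod
    (isCompact_stdSimplex ℝ (Fin (finrank ℝ E + 1)))).image
    (f := fun p => ∑ j, p.2 j • p.1 j) (by fun_prop)
  convert hcpt
  ext x
  constructor
  · intro hx
    obtain ⟨z, w, hz, hw, hx⟩ := exists_sum_smul_of_mem_convexHull hx
    exact ⟨(z, w), ⟨fun j _ => hz j, hw⟩, hx⟩
  · rintro ⟨⟨z, w⟩, ⟨hz, hw⟩, rfl⟩
    exact (convex_convexHull ℝ s).sum_mem (fun j _ => hw.1 j) hw.2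
      fun j _ => subset_convexHull ℝ s (hz j trivial)

theorem ContinuousOn.integrable_of_measure_compl_eq_zero {F : Type*} [NormedAddCommGroup F]
    {K : Set ℝ} (hK : IsCompact K) {g : ℝ → F} (hg : ContinuousOn g K)
    {σ : Measure ℝ} [IsFiniteMeasure σ] (hσ : σ Kᶜ = 0) : Integrable g σ := by
  have h : σ.restrict K = σ := Measure.restrict_eq_self_of_ae_mem (mem_ae_iff.2 hσ)
  rw [← h]
  exact hg.integrableOn_compact hK

theorem ContinuousOn.exists_boundedContinuousFunction_eqOn {K : Set ℝ} (hK : IsCompact K)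
    {g : ℝ → ℝ} (hg : ContinuousOn g K) :
    ∃ G : BoundedContinuousFunction ℝ ℝ, EqOn G g K := by
  have : CompactSpace K := isCompact_iff_compactSpace.1 hK
  obtain ⟨G, -, hG⟩ := BoundedContinuousFunction.exists_norm_eq_domRestrict_eq_of_closed
    (BoundedContinuousFunction.mkOfCompact ⟨K.domRestrict g, hg.domRestrict⟩) hK.isClosed
  refine ⟨G, fun x hx => ?_⟩
  simpa using DFunLike.congr_fun hG ⟨x, hx⟩

open scoped NNReal in
/-- A linear functional of a measure on a compact set attains its maximum under moment
constraints, provided some combination of the constraint functions is positive. -/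
theorem exists_isFeasible_forall_integral_le {k : ℕ} {A B : ℝ} {Ψ : Fin k → ℝ → ℝ} {Ω : ℝ → ℝ}
    (hΨ : ∀ i, ContinuousOn (Ψ i) (Icc A B)) (hΩ : ContinuousOn Ω (Icc A B))
    {a : Fin k → ℝ} {δ : ℝ} (hδ : 0 < δ) (hpos : ∀ x ∈ Icc A B, δ ≤ ∑ i, a i * Ψ i x)
    {c : Fin k → ℝ} (hS : ∃ σ, IsFeasible A B Ψ c σ) :
    ∃ σp, IsFeasible A B Ψ c σp ∧ ∀ σ, IsFeasible A B Ψ c σ → ∫ x, Ω x ∂σ ≤ ∫ x, Ω x ∂σp := by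
  have hK : IsCompact (Icc A B) := isCompact_Icc
  choose G hG using fun i => (hΨ i).exists_boundedContinuousFunction_eqOn hK
  obtain ⟨W, hW⟩ := hΩ.exists_boundedContinuousFunction_eqOn hK
  have key {f g : ℝ → ℝ} (hfg : EqOn f g (Icc A B)) {σ : Measure ℝ} (hσ : σ (Icc A B)ᶜ = 0) :
      ∫ x, f x ∂σ = ∫ x, g x ∂σ :=
    integral_congr_ae (Filter.mem_of_superset (mem_ae_iff.2 hσ) hfg)
  have hmass {σ : Measure ℝ} (h : IsFeasible A B Ψ c σ) :
      σ.real univ ≤ (∑ i, a i * c i) / δ := by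
    obtain ⟨_, hσ, hc⟩ := h
    have hint i := (hΨ i).integrable_of_measure_compl_eq_zero hK hσ
    rw [le_div_iff₀ hδ]
    calc σ.real univ * δ = ∫ _, δ ∂σ := by simp
      _ ≤ ∫ x, ∑ i, a i * Ψ i x ∂σ :=
        integral_mono_ae (integrable_const _)
          (integrable_finsetSum _ fun i _ => (hint i).const_mul _)
          (Filter.mem_of_superset (mem_ae_iff.2 hσ) hpos)
      _ = ∑ i, a i * c i := by
        rw [integral_finsetSum _ fun i _ => (hint i).const_mul _]
        simp [integral_const_mul, hc]
  let C : ℝ≥0 := ((∑ i, a i * c i) / δ).toNNReal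
  let T : Set (FiniteMeasure ℝ) := {μ | μ.mass ≤ C ∧ μ (Icc A B)ᶜ = 0} ∩
    ⋂ i, {μ | ∫ x, G i x ∂(μ : Measure ℝ) = c i}
  have hT : IsCompact T :=
    (isCompact_setOfPred_finiteMeasure_le_of_isCompact C hK).inter_right <|
      isClosed_iInter fun i => isClosed_eq
        (FiniteMeasure.continuous_integral_boundedContinuousFunction (G i)) continuous_const
  have hmem {μ : FiniteMeasure ℝ} : μ ∈ T ↔ IsFeasible A B Ψ c μ := by
    have h0 : μ (Icc A B)ᶜ = 0 ↔ (μ : Measure ℝ) (Icc A B)ᶜ = 0 :=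
      FiniteMeasure.null_iff_toMeasure_null μ _
    constructor
    · rintro ⟨⟨-, h⟩, h'⟩
      rw [h0] at h
      refine ⟨inferInstance, h, fun i => ?_⟩
      rw [← key (hG i) h]
      exact mem_iInter.1 h' i
    · intro h
      refine ⟨⟨?_, h0.2 h.2.1⟩, mem_iInter.2 fun i => (key (hG i) h.2.1).trans (h.2.2 i)⟩
      exact NNReal.le_toNNReal_of_coe_le (hmass h)
  obtain ⟨σ₀, hσ₀⟩ := hS
  obtain ⟨μ, hμT, hμ⟩ := hT.exists_isMaxOn ⟨⟨σ₀, hσ₀.1⟩, hmem.2 hσ₀⟩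
    (FiniteMeasure.continuous_integral_boundedContinuousFunction W).continuousOn
  refine ⟨μ, hmem.1 hμT, fun σ hσ => ?_⟩
  have := hμ (hmem.2 hσ : (⟨σ, hσ.1⟩ : FiniteMeasure ℝ) ∈ T)
  rw [← key hW hσ.2.1, ← key hW (hmem.1 hμT).2.1]
  exact this

theorem IsChebyshevSystem.eq_zero_of_sum_eq_zero {A B : ℝ} {k : ℕ} {Ψ : Fin k → ℝ → ℝ}
    (h : IsChebyshevSystem A B Ψ) {s : Finset ℝ} (hs : ∀ z ∈ s, z ∈ Icc A B) (hk : s.card = k)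
    {w : ℝ → ℝ} (hw : ∀ i, ∑ z ∈ s, w z * Ψ i z = 0) : ∀ z ∈ s, w z = 0 := by
  let e := s.orderEmbOfFin hk
  have hdet := h e e.strictMono fun j => hs _ (s.orderEmbOfFin_mem hk j)
  have hv := Matrix.eq_zero_of_mulVec_eq_zero hdet.ne' (v := w ∘ e) <| by
    ext i
    have := hw i
    rw [← s.map_orderEmbOfFin_univ hk, Finset.sum_map] at this
    exact (Finset.sum_congr rfl fun j _ => mul_comm _ _).trans this
  intro z hz
  rw [← s.map_orderEmbOfFin_univ hk, Finset.mem_map] at hz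
  obtain ⟨j, -, rfl⟩ := hz
  exact congrFun hv j

theorem IsChebyshevSystem.eq_zero_of_nonneg_of_sum_eq_zero {A B : ℝ} {k : ℕ}
    {Ψ : Fin k → ℝ → ℝ} (h : IsChebyshevSystem A B Ψ) (hk : 0 < k) {s : Finset ℝ}
    (hs : ∀ z ∈ s, z ∈ Icc A B) (hcard : s.card = k + 1)
    {w : ℝ → ℝ} (hw₀ : ∀ z, 0 ≤ w z) (hw : ∀ i, ∑ z ∈ s, w z * Ψ i z = 0) :
    ∀ z ∈ s, w z = 0 := by
  obtain ⟨m, rfl⟩ : ∃ m, k = m + 1 := ⟨k - 1, by omega⟩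
  let e := s.orderEmbOfFin hcard
  have he j : e j ∈ Icc A B := hs _ (s.orderEmbOfFin_mem hcard j)
  let M : Matrix (Fin (m + 1)) (Fin (m + 1)) ℝ := Matrix.of fun i j => Ψ i (e j.succ)
  have hM : 0 < M.det :=
    h (e ∘ Fin.succ) (e.strictMono.comp (Fin.strictMono_succ)) fun j => he _
  have hM' : 0 < (M.updateCol 0 fun i => Ψ i (e 0)).det := by
    convert h (e ∘ Fin.succAbove 1) (e.strictMono.comp (Fin.strictMono_succAbove 1))
      (fun j => he _) using 2
    ext i j
    refine Fin.cases ?_ (fun j => ?_) j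
    · simp
    · have : (1 : Fin (m + 2)).succAbove j.succ = j.succ.succ := by
        rw [← Fin.succ_zero_eq_one, Fin.succ_succAbove_succ, Fin.zero_succAbove]
      simp [M, this]
  have hmul : M.mulVec (fun j => w (e j.succ)) = -w (e 0) • fun i => Ψ i (e 0) := by
    ext i
    have := hw i
    rw [← s.map_orderEmbOfFin_univ hcard, Finset.sum_map, Fin.sum_univ_succ] at this
    simp only [Matrix.mulVec, dotProduct, M, Matrix.of_apply, Pi.smul_apply, smul_eq_mul, e,
      mul_comm (Ψ i _)]
    simp only [RelEmbedding.coe_toEmbedding] at this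
    linarith
  have hcramer := congrFun (congrArg (fun v => M.adjugate.mulVec v) hmul) 0
  simp only [Matrix.mulVec_mulVec, Matrix.adjugate_mul, Matrix.smul_mulVec, Matrix.one_mulVec,
    Matrix.mulVec_smul, ← Matrix.cramer_eq_adjugate_mulVec, Pi.smul_apply, smul_eq_mul,
    Matrix.cramer_apply] at hcramer
  have h₁ := mul_nonneg hM.le (hw₀ (e (Fin.succ 0)))
  have h₀ := mul_nonneg (hw₀ (e 0)) hM'.le
  have hzero : w (e 0) = 0 := by
    have : w (e 0) * (M.updateCol 0 fun i => Ψ i (e 0)).det = 0 := by linarith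
    exact (mul_eq_zero.1 this).resolve_right hM'.ne'
  rw [hzero, neg_zero, zero_smul] at hmul
  have hsucc := Matrix.eq_zero_of_mulVec_eq_zero hM.ne' hmul
  intro z hz
  rw [← s.map_orderEmbOfFin_univ hcard, Finset.mem_map] at hz
  obtain ⟨j, -, rfl⟩ := hz
  exact Fin.cases hzero (congrFun hsucc) j

theorem exists_finset_superset_card_eq {K : Set ℝ} (hK : K.Infinite) {s : Finset ℝ}
    (hs : ↑s ⊆ K) {n : ℕ} (hn : s.card ≤ n) : ∃ t : Finset ℝ, s ⊆ t ∧ ↑t ⊆ K ∧ t.card = n := by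
  classical
  obtain ⟨u, hu, hcard⟩ := (hK.sdiff s.finite_toSet).exists_subset_card_eq (n - s.card)
  refine ⟨s ∪ u, Finset.subset_union_left, ?_, ?_⟩
  · rw [Finset.coe_union]
    exact union_subset hs fun x hx => (hu hx).1
  · rw [Finset.card_union_of_disjoint, hcard]
    · omega
    · exact Finset.disjoint_right.2 fun x hx hxs => (hu hx).2 hxs

/-- A Chebyshev system admits a strictly positive linear combination. -/
theorem IsChebyshevSystem.exists_pos_combination {A B : ℝ} (hAB : A < B) {k : ℕ} (hk : 0 < k)
    {Ψ : Fin k → ℝ → ℝ} (hΨ : ∀ i, ContinuousOn (Ψ i) (Icc A B))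
    (h : IsChebyshevSystem A B Ψ) :
    ∃ (a : Fin k → ℝ) (δ : ℝ), 0 < δ ∧ ∀ x ∈ Icc A B, δ ≤ ∑ i, a i * Ψ i x := by
  classical
  let γ : ℝ → Fin k → ℝ := fun x i => Ψ i x
  have hγ : IsCompact (convexHull ℝ (γ '' Icc A B)) :=
    (isCompact_Icc.image_of_continuousOn (continuousOn_pi.2 hΨ)).convexHull_of_finiteDimensional
  have h0 : (0 : Fin k → ℝ) ∉ convexHull ℝ (γ '' Icc A B) := by
    intro hmem
    obtain ⟨z, v, hz, ⟨hv₀, hv₁⟩, hsum⟩ := exists_sum_smul_of_mem_convexHull hmem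
    choose x hx hxz using hz
    obtain ⟨t, hst, htK, hcard⟩ := exists_finset_superset_card_eq (Icc_infinite hAB)
      (s := Finset.univ.image x) (n := k + 1)
      (by simpa [Set.subset_def] using hx) (Finset.card_image_le.trans (by simp))
    have hxt j : x j ∈ t := hst (Finset.mem_image_of_mem x (Finset.mem_univ j))
    let w : ℝ → ℝ := fun y => ∑ j, if x j = y then v j else 0
    have hw (g : ℝ → ℝ) : ∑ y ∈ t, w y * g y = ∑ j, v j * g (x j) := by
      simp only [w, Finset.sum_mul, ite_mul, zero_mul]
      rw [Finset.sum_comm]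
      refine Finset.sum_congr rfl fun j _ => ?_
      rw [Finset.sum_ite_eq, if_pos (hxt j)]
    have hwz := h.eq_zero_of_nonneg_of_sum_eq_zero hk (fun y hy => htK hy) hcard
      (w := w) (fun y => Finset.sum_nonneg fun j _ => by split_ifs <;> simp [hv₀ j]) fun i => by
        rw [hw]
        simpa [← hxz, γ] using congrFun hsum i
    have h1 := hw fun _ => 1
    rw [Finset.sum_eq_zero fun y hy => by rw [hwz y hy, zero_mul]] at h1
    simp [hv₁] at h1
  obtain ⟨f, u, hu, hf⟩ := geometric_hahn_banach_point_closed (convex_convexHull ℝ _)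
    hγ.isClosed h0
  refine ⟨fun i => f (Pi.single i 1), u, by simpa using hu, fun x hx => ?_⟩
  have := (hf _ (subset_convexHull ℝ _ (mem_image_of_mem γ hx))).le
  rw [← Finset.univ_sum_single (γ x), map_sum] at this
  refine this.trans_eq (Finset.sum_congr rfl fun i _ => ?_)
  rw [mul_comm (f _), ← smul_eq_mul, ← map_smul, ← Pi.single_smul, smul_eq_mul, mul_one]

/-- The moment vectors `∫ g dσ` of the finite measures `σ` living on `K`. -/
def momentCone {F : Type*} [NormedAddCommGroup F] [NormedSpace ℝ F] (K : Set ℝ) (g : ℝ → F) :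
    Set F :=
  {v | ∃ σ : Measure ℝ, IsFiniteMeasure σ ∧ σ Kᶜ = 0 ∧ ∫ x, g x ∂σ = v}

section momentCone

variable {F : Type*} [NormedAddCommGroup F] [NormedSpace ℝ F] {K : Set ℝ} {g : ℝ → F}

theorem smul_mem_momentCone {v : F} (hv : v ∈ momentCone K g) {a : ℝ} (ha : 0 ≤ a) :
    a • v ∈ momentCone K g := by
  obtain ⟨σ, _, hσ, rfl⟩ := hv
  lift a to NNReal using ha
  exact ⟨a • σ, inferInstance, by simp [hσ], integral_smul_nnreal_measure g a⟩

theorem add_mem_momentCone (hK : IsCompact K) (hg : ContinuousOn g K) {v w : F}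
    (hv : v ∈ momentCone K g) (hw : w ∈ momentCone K g) : v + w ∈ momentCone K g := by
  obtain ⟨σ, _, hσ, rfl⟩ := hv
  obtain ⟨τ, _, hτ, rfl⟩ := hw
  exact ⟨σ + τ, inferInstance, by simp [hσ, hτ],
    integral_add_measure (hg.integrable_of_measure_compl_eq_zero hK hσ)
      (hg.integrable_of_measure_compl_eq_zero hK hτ)⟩

theorem convex_momentCone (hK : IsCompact K) (hg : ContinuousOn g K) :
    Convex ℝ (momentCone K g) := fun _ hv _ hw _ _ ha hb _ =>
  add_mem_momentCone hK hg (smul_mem_momentCone hv ha) (smul_mem_momentCone hw hb)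

theorem zero_mem_momentCone : (0 : F) ∈ momentCone K g :=
  ⟨0, inferInstance, by simp, by simp⟩

theorem apply_mem_momentCone [CompleteSpace F] {x : ℝ} (hx : x ∈ K) : g x ∈ momentCone K g :=
  ⟨Measure.dirac x, inferInstance, by simp [hx], integral_dirac g x⟩

theorem interior_momentCone_nonempty [FiniteDimensional ℝ F] (hK : IsCompact K)
    (hg : ContinuousOn g K) {s : Finset ℝ} (hs : ↑s ⊆ K) (hspan : Submodule.span ℝ (g '' s) = ⊤) :
    (interior (momentCone K g)).Nonempty := by
  have := FiniteDimensional.complete ℝ F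
  rw [(convex_momentCone hK hg).interior_nonempty_iff_affineSpan_eq_top,
    AffineSubspace.affineSpan_eq_top_iff_vectorSpan_eq_top_of_nonempty _ _ _
      ⟨0, zero_mem_momentCone⟩,
    vectorSpan_eq_span_vsub_set_right ℝ zero_mem_momentCone, eq_top_iff, ← hspan]
  refine Submodule.span_mono ?_
  rintro _ ⟨x, hx, rfl⟩
  exact ⟨g x, apply_mem_momentCone (hs hx), by simp⟩

theorem integral_eq_sum_of_measure_compl_eq_zero [CompleteSpace F] {σ : Measure ℝ} [IsFiniteMeasure σ]
    {s : Finset ℝ} (hσ : σ (↑s)ᶜ = 0) (g : ℝ → F) :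
    ∫ x, g x ∂σ = ∑ z ∈ s, σ.real {z} • g z := by
  have h : σ.restrict s = σ := Measure.restrict_eq_self_of_ae_mem (mem_ae_iff.2 hσ)
  rw [← setIntegral_finset s, h]
  exact IntegrableOn.finset

theorem measure_eq_of_forall_mem_real_singleton_eq {σ τ : Measure ℝ} [IsFiniteMeasure σ]
    [IsFiniteMeasure τ] {s : Finset ℝ} (hσ : σ (↑s)ᶜ = 0) (hτ : τ (↑s)ᶜ = 0)
    (h : ∀ z ∈ s, σ.real {z} = τ.real {z}) : σ = τ := by
  ext u hu
  rw [← measureReal_eq_measureReal_iff, ← integral_indicator_one hu, ← integral_indicator_one hu,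
    integral_eq_sum_of_measure_compl_eq_zero hσ, integral_eq_sum_of_measure_compl_eq_zero hτ]
  exact Finset.sum_congr rfl fun z hz => by rw [h z hz]

/-- A moment vector which is not interior to the moment cone has a unique representing measure. -/
theorem eq_of_integral_notMem_interior_momentCone [FiniteDimensional ℝ F] (hK : IsCompact K)
    (hKi : K.Infinite) (hg : ContinuousOn g K)
    (hind : ∀ s : Finset ℝ, ↑s ⊆ K → s.card = finrank ℝ F → LinearIndepOn ℝ g ↑s)
    {σ τ : Measure ℝ} [IsFiniteMeasure σ] [IsFiniteMeasure τ] (hσ : σ Kᶜ = 0) (hτ : τ Kᶜ = 0)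
    (hστ : ∫ x, g x ∂σ = ∫ x, g x ∂τ)
    (hint : ∫ x, g x ∂σ ∉ interior (momentCone K g)) : σ = τ := by
  have := FiniteDimensional.complete ℝ F
  have hspan (s : Finset ℝ) (hs : ↑s ⊆ K) (hcard : s.card = finrank ℝ F) :
      Submodule.span ℝ (g '' s) = ⊤ := by
    have := (hind s hs hcard).span_eq_top_of_card_eq_finrank' (by simpa using hcard)
    rwa [← image_eq_range] at this
  obtain ⟨s₀, hs₀, hcard₀⟩ := hKi.exists_subset_card_eq (finrank ℝ F)
  obtain ⟨f, hf, hmax⟩ := geometric_hahn_banach_of_nonempty_interior_point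
    (convex_momentCone hK hg) hint (interior_momentCone_nonempty hK hg hs₀ (hspan s₀ hs₀ hcard₀))
  set v := ∫ x, g x ∂σ with hv
  have hv₀ : 0 ≤ f v := by simpa using hmax 0 zero_mem_momentCone
  have hnonpos {x : ℝ} (hx : x ∈ K) : f (g x) ≤ 0 := by
    by_contra! hpos
    have := hmax _ (smul_mem_momentCone (apply_mem_momentCone (g := g) hx)
      (a := f v / f (g x) + 1) (by positivity))
    rw [map_smul, smul_eq_mul, add_mul, div_mul_cancel₀ _ hpos.ne', one_mul] at this
    linarith
  let Z : Set ℝ := {x ∈ K | f (g x) = 0}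
  have hZcard (s : Finset ℝ) (hs : ↑s ⊆ Z) : s.card ≠ finrank ℝ F := fun hcard =>
    hf <| ContinuousLinearMap.coe_injective <|
      LinearMap.ext_on (hspan s (fun x hx => (hs hx).1) hcard) <| by
        rintro _ ⟨x, hx, rfl⟩
        exact (hs hx).2
  have hZ : Z.Finite := by
    by_contra hZ
    obtain ⟨s, hs, hcard⟩ := Set.Infinite.exists_subset_card_eq hZ (finrank ℝ F)
    exact hZcard s hs hcard
  have hsupp {ρ : Measure ℝ} [IsFiniteMeasure ρ] (hρ : ρ Kᶜ = 0) (hρv : ∫ x, g x ∂ρ = v) :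
      ρ Zᶜ = 0 := by
    have hgi := hg.integrable_of_measure_compl_eq_zero hK hρ
    have hmem : ∀ᵐ x ∂ρ, x ∈ K := mem_ae_iff.2 hρ
    have hle : 0 ≤ᵐ[ρ] fun x => -f (g x) := hmem.mono fun x hx => neg_nonneg.2 (hnonpos hx)
    have h0 : ∫ x, -f (g x) ∂ρ = 0 := by
      refine le_antisymm ?_ (integral_nonneg_of_ae hle)
      rw [integral_neg, f.integral_comp_comm hgi, hρv]
      linarith
    have := (integral_eq_zero_iff_of_nonneg_ae hle (f.integrable_comp hgi).neg).1 h0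
    change ∀ᵐ x ∂ρ, x ∈ Z
    filter_upwards [hmem, this] with x hx hx0
    exact ⟨hx, by simpa using hx0⟩
  have hσZ : σ (↑hZ.toFinset)ᶜ = 0 := by simpa using hsupp hσ rfl
  have hτZ : τ (↑hZ.toFinset)ᶜ = 0 := by simpa using hsupp hτ hστ.symm
  have hlt : hZ.toFinset.card ≤ finrank ℝ F := by
    by_contra! hlt
    obtain ⟨s, hs, hcard⟩ := Finset.exists_subset_card_eq hlt.le
    exact hZcard s (fun x hx => by simpa using hs hx) hcard
  obtain ⟨t, hZt, htK, hcard⟩ := exists_finset_superset_card_eq hKi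
    (s := hZ.toFinset) (by rw [hZ.coe_toFinset]; exact fun x hx => hx.1) hlt
  have hsub : (↑hZ.toFinset : Set ℝ) ⊆ t := hZt
  have hσt : σ (↑t)ᶜ = 0 := measure_mono_null (compl_subset_compl.2 hsub) hσZ
  have hτt : τ (↑t)ᶜ = 0 := measure_mono_null (compl_subset_compl.2 hsub) hτZ
  refine measure_eq_of_forall_mem_real_singleton_eq hσt hτt fun z hz => ?_
  have hlin := linearIndepOn_finset_iff.1 (hind t htK hcard) (fun z => σ.real {z} - τ.real {z})
    (by simp_rw [sub_smul]
        rw [Finset.sum_sub_distrib, ← integral_eq_sum_of_measure_compl_eq_zero hσt,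
          ← integral_eq_sum_of_measure_compl_eq_zero hτt, ← hv, hστ, sub_self])
  exact sub_eq_zero.1 (hlin z hz)

end momentCone

/-- Existence and uniqueness of the maximizing measure, under the nondegeneracy consequences of
the Chebyshev property that are insensitive to the sign of `Ω`. -/
theorem existsUnique_isFeasible_forall_integral_le {k : ℕ} {A B : ℝ} (hAB : A < B)
    {Ψ : Fin k → ℝ → ℝ} {Ω : ℝ → ℝ}
    (hΨ : ∀ i, ContinuousOn (Ψ i) (Icc A B)) (hΩ : ContinuousOn Ω (Icc A B))
    {a : Fin k → ℝ} {δ : ℝ} (hδ : 0 < δ) (hpos : ∀ x ∈ Icc A B, δ ≤ ∑ i, a i * Ψ i x)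
    (hind : ∀ s : Finset ℝ, ↑s ⊆ Icc A B → s.card = k + 1 → ∀ w : ℝ → ℝ,
      (∀ i, ∑ z ∈ s, w z * Ψ i z = 0) → ∑ z ∈ s, w z * Ω z = 0 → ∀ z ∈ s, w z = 0)
    {c : Fin k → ℝ} (hS : ∃ σ, IsFeasible A B Ψ c σ) :
    ∃! σp, IsFeasible A B Ψ c σp ∧ ∀ σ, IsFeasible A B Ψ c σ → ∫ x, Ω x ∂σ ≤ ∫ x, Ω x ∂σp := by
  obtain ⟨σp, hσp, hmax⟩ := exists_isFeasible_forall_integral_le hΨ hΩ hδ hpos hS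
  refine ⟨σp, ⟨hσp, hmax⟩, fun τ ⟨hτ, hτmax⟩ => ?_⟩
  let g : ℝ → (Fin k → ℝ) × ℝ := fun x => (fun i => Ψ i x, Ω x)
  have hg : ContinuousOn g (Icc A B) := (continuousOn_pi.2 hΨ).prodMk hΩ
  have hmoment {σ : Measure ℝ} [IsFiniteMeasure σ] (hσ : σ (Icc A B)ᶜ = 0) :
      ∫ x, g x ∂σ = (fun i => ∫ x, Ψ i x ∂σ, ∫ x, Ω x ∂σ) := by
    have hi i := (hΨ i).integrable_of_measure_compl_eq_zero isCompact_Icc hσ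
    rw [integral_pair (Integrable.of_eval hi)
      (hΩ.integrable_of_measure_compl_eq_zero isCompact_Icc hσ)]
    congr 1
    ext i
    exact eval_integral hi i
  obtain ⟨_, hσ, hσc⟩ := hσp
  obtain ⟨_, hτ', hτc⟩ := id hτ
  have heq : ∫ x, Ω x ∂τ = ∫ x, Ω x ∂σp := le_antisymm (hmax τ hτ) (hτmax σp ⟨‹_›, hσ, hσc⟩)
  refine (eq_of_integral_notMem_interior_momentCone isCompact_Icc (Icc_infinite hAB) hg
    (fun s hs hcard => linearIndepOn_finset_iff.2 fun w hw => ?_) hσ hτ' ?_ ?_).symm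
  · refine hind s hs (by simpa using hcard) w (fun i => ?_) ?_
    · simpa [g, Prod.fst_sum] using congrFun (congrArg Prod.fst hw) i
    · simpa [g, Prod.snd_sum] using congrArg Prod.snd hw
  · rw [hmoment hσ, hmoment hτ', heq]
    simp_rw [hσc, hτc]
  · intro hint
    rw [hmoment hσ] at hint
    have hcont : ContinuousAt (fun ε : ℝ => ((fun i => ∫ x, Ψ i x ∂σp, ∫ x, Ω x ∂σp + ε) :
        (Fin k → ℝ) × ℝ)) 0 := by fun_prop
    have hev := hcont.eventually (p := fun v => v ∈ momentCone (Icc A B) g)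
      (by simpa using mem_interior_iff_mem_nhds.1 hint)
    obtain ⟨ε, hε, hεpos⟩ := ((hev.filter_mono nhdsWithin_le_nhds).and
      (self_mem_nhdsWithin : Ioi (0 : ℝ) ∈ nhdsWithin 0 (Ioi 0))).exists
    obtain ⟨ρ, _, hρ, hρv⟩ := hε
    rw [hmoment hρ, Prod.mk.injEq] at hρv
    have := hmax ρ ⟨‹_›, hρ, fun i => (congrFun hρv.1 i).trans (hσc i)⟩
    have hεpos : 0 < ε := hεpos
    linarith [hρv.2]

/-- If `{Ψ₀,…,Ψ_{k-1}}` and `{Ψ₀,…,Ψ_{k-1},Ω}` are Chebyshev systems on `[A,B]` and the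
feasible set of measures with prescribed `Ψ`-moments `c⁰` is nonempty, then there is a
unique measure `σ⁺` in the feasible set maximizing `∫ Ω dσ`, and a unique measure `σ⁻`
minimizing it. -/
theorem exists_unique_principal_representations
    {k : ℕ} (hk : 0 < k) (A B : ℝ) (hAB : A < B)
    (Ψ : Fin k → ℝ → ℝ) (Ω : ℝ → ℝ)
    (hcontΨ : ∀ i, ContinuousOn (Ψ i) (Set.Icc A B))
    (hcontΩ : ContinuousOn Ω (Set.Icc A B))
    (hCheb : IsChebyshevSystem A B Ψ)
    (hCheb' : IsChebyshevSystem A B (Fin.snoc Ψ Ω))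
    (c : Fin k → ℝ)
    (hS : ∃ σ : Measure ℝ, IsFeasible A B Ψ c σ) :
    (∃! σp : Measure ℝ, IsFeasible A B Ψ c σp ∧
        ∀ σ : Measure ℝ, IsFeasible A B Ψ c σ → ∫ x, Ω x ∂σ ≤ ∫ x, Ω x ∂σp) ∧
      (∃! σm : Measure ℝ, IsFeasible A B Ψ c σm ∧
        ∀ σ : Measure ℝ, IsFeasible A B Ψ c σ → ∫ x, Ω x ∂σm ≤ ∫ x, Ω x ∂σ) := by
  obtain ⟨a, δ, hδ, hpos⟩ := hCheb.exists_pos_combination hAB hk hcontΨ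
  have hind (s : Finset ℝ) (hs : ↑s ⊆ Icc A B) (hcard : s.card = k + 1) (w : ℝ → ℝ)
      (hw : ∀ i, ∑ z ∈ s, w z * Ψ i z = 0) (hw' : ∑ z ∈ s, w z * Ω z = 0) : ∀ z ∈ s, w z = 0 :=
    hCheb'.eq_zero_of_sum_eq_zero (fun z hz => hs hz) hcard
      (Fin.lastCases (by simpa using hw') (by simpa using hw))
  refine ⟨existsUnique_isFeasible_forall_integral_le hAB hcontΨ hcontΩ hδ hpos hind hS, ?_⟩
  have hmin := existsUnique_isFeasible_forall_integral_le hAB hcontΨ hcontΩ.neg hδ hpos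
    (fun s hs hcard w hw hw' => hind s hs hcard w hw (by simpa using hw')) hS
  simpa only [Pi.neg_apply, integral_neg, neg_le_neg_iff] using hmin
end

section
/- Let A < B, let Ψ₀,…,Ψ_{k−1} : [A,B] → ℝ be continuous functions forming a Chebyshev system, and let Ω₁, Ω₂ : [A,B] → ℝ be continuous functions such that both {Ψ₀,…,Ψ_{k−1}, Ω₁} and {Ψ₀,…,Ψ_{k−1}, Ω₂} are Chebyshev systems on [A,B]. Fix c⁰ ∈ ℝ^k and let S = { σ : σ finite nonnegative Borel measure on [A,B] with ∫_A^B Ψ_i dσ = c⁰_i for i = 0,…,k−1 } be nonempty. If σ₁ ∈ S maximizes ∫_A^B Ω₁ dσ over S and σ₂ ∈ S maximizes ∫_A^B Ω₂ dσ over S, then σ₁ = σ₂; likewise, if σ₁ minimizes ∫_A^B Ω₁ dσ over S and σ₂ minimizes ∫_A^B Ω₂ dσ over S, then σ₁ = σ₂. In particular, the maximizing and minimizing measures do not depend on the function Ω. -/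
open MeasureTheory Set

/-- A family of functions whose collocation matrix at any increasing tuple of points of `[A,B]`
is nonsingular. -/
def IsNonsingularSystem (A B : ℝ) {n : ℕ} (Φ : Fin n → ℝ → ℝ) : Prop :=
  ∀ x : Fin n → ℝ, StrictMono x → (∀ j, x j ∈ Icc A B) →
    (Matrix.of fun i j : Fin n => Φ i (x j)).det ≠ 0

theorem det_snoc_linear_comb {k : ℕ} (Ψ : Fin k → ℝ → ℝ) (Ω₁ Ω₂ : ℝ → ℝ) (a b : ℝ)
    (x : Fin (k + 1) → ℝ) :
    (Matrix.of fun i j : Fin (k + 1) =>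
      (Fin.snoc Ψ (fun y => a * Ω₁ y + b * Ω₂ y) : Fin (k + 1) → ℝ → ℝ) i (x j)).det =
    a * (Matrix.of fun i j => (Fin.snoc Ψ Ω₁ : Fin (k + 1) → ℝ → ℝ) i (x j)).det +
    b * (Matrix.of fun i j => (Fin.snoc Ψ Ω₂ : Fin (k + 1) → ℝ → ℝ) i (x j)).det := by
  have key : ∀ Ω : ℝ → ℝ,
      (Matrix.of fun i j : Fin (k + 1) => (Fin.snoc Ψ Ω : Fin (k + 1) → ℝ → ℝ) i (x j)) =
      (Matrix.of fun i j : Fin (k + 1) =>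
        (Fin.snoc Ψ 0 : Fin (k + 1) → ℝ → ℝ) i (x j)).updateRow (Fin.last k)
        (fun j => Ω (x j)) := by
    intro Ω
    ext i j
    refine Fin.lastCases ?_ (fun i => ?_) i <;> simp [Matrix.updateRow_apply]
  rw [key, key Ω₁, key Ω₂, ← Matrix.det_updateRow_smul, ← Matrix.det_updateRow_smul,
    ← Matrix.det_updateRow_add]
  rfl

theorem IsNonsingularSystem.eq_zero_of_sum_eq_zero {A B : ℝ} {n : ℕ} {Φ : Fin n → ℝ → ℝ}
    (hΦ : IsNonsingularSystem A B Φ) {G : Finset ℝ} (hG : ∀ z ∈ G, z ∈ Icc A B)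
    (hcard : G.card = n) {u : ℝ → ℝ} (hu : ∀ i, ∑ z ∈ G, u z * Φ i z = 0) :
    ∀ z ∈ G, u z = 0 := by
  have hdet := hΦ (G.orderEmbOfFin hcard) (G.orderEmbOfFin hcard).strictMono
    fun j => hG _ (G.orderEmbOfFin_mem hcard j)
  have hz : (fun j => u (G.orderEmbOfFin hcard j)) = 0 := by
    refine Matrix.eq_zero_of_mulVec_eq_zero hdet (funext fun i => ?_)
    have := hu i
    rw [← G.map_orderEmbOfFin_univ hcard, Finset.sum_map] at this
    simpa [Matrix.mulVec, dotProduct, mul_comm] using this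
  intro z hzG
  obtain ⟨j, rfl⟩ : z ∈ range (G.orderEmbOfFin hcard) := by
    rwa [Finset.range_orderEmbOfFin]
  exact congrFun hz j

theorem IsNonsingularSystem.finite_zeros {A B : ℝ} {n : ℕ} {Φ : Fin n → ℝ → ℝ}
    (hΦ : IsNonsingularSystem A B Φ) {a : Fin n → ℝ} (ha : a ≠ 0) :
    {x ∈ Icc A B | ∑ i, a i * Φ i x = 0}.Finite := by
  by_contra hinf
  obtain ⟨G, hG, hcard⟩ := Set.Infinite.exists_subset_card_eq hinf n
  refine ha (Matrix.eq_zero_of_vecMul_eq_zero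
    (hΦ (G.orderEmbOfFin hcard) (G.orderEmbOfFin hcard).strictMono
      fun j => (hG (G.orderEmbOfFin_mem hcard j)).1) (funext fun j => ?_))
  simpa [Matrix.vecMul, dotProduct] using (hG (G.orderEmbOfFin_mem hcard j)).2

theorem exists_relation_of_lt_card {α : Type*} {n : ℕ} (Φ : Fin n → α → ℝ) {F : Finset α}
    (hF : n < F.card) :
    ∃ v : α → ℝ, (∃ z ∈ F, v z ≠ 0) ∧ (∀ z ∉ F, v z = 0) ∧
      ∀ i, ∑ z ∈ F, v z * Φ i z = 0 := by
  classical
  have hdep : ¬ LinearIndependent ℝ (fun z : F => fun i => Φ i z) := fun h => by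
    have := h.fintype_card_le_finrank
    simp at this
    omega
  obtain ⟨g, hg, z, hz⟩ := Fintype.not_linearIndependent_iff.1 hdep
  refine ⟨fun x => if hx : x ∈ F then g ⟨x, hx⟩ else 0, ⟨z, z.2, by simpa using hz⟩,
    fun x hx => by simp [hx], fun i => ?_⟩
  rw [← Finset.sum_coe_sort]
  simpa using congrFun hg i

/-- Every nonzero linear relation dominates in sign a nonzero relation of small support. -/
theorem exists_conformal_relation {α : Type*} {n : ℕ} (Φ : Fin n → α → ℝ) (F : Finset α)
    (w : α → ℝ) (hw : ∃ z ∈ F, w z ≠ 0) (hrel : ∀ i, ∑ z ∈ F, w z * Φ i z = 0) :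
    ∃ G ⊆ F, ∃ u : α → ℝ, G.card ≤ n + 1 ∧ (∃ z ∈ G, u z ≠ 0) ∧ (∀ z ∉ G, u z = 0) ∧
      (∀ i, ∑ z ∈ G, u z * Φ i z = 0) ∧
      ∀ z, (0 < u z → 0 < w z) ∧ (u z < 0 → w z < 0) := by
  classical
  induction hN : F.card generalizing F w with
  | zero => simp_all
  | succ N ih =>
    by_cases hcard : F.card ≤ n + 1
    · obtain ⟨z, hz, hwz⟩ := hw
      refine ⟨F, subset_rfl, fun x => if x ∈ F then w x else 0, hcard,
        ⟨z, hz, by simpa [hz] using hwz⟩, fun x hx => by simp [hx], fun i => ?_, fun x => ?_⟩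
      · rw [← hrel i]
        exact Finset.sum_congr rfl fun x hx => by simp [hx]
      · dsimp only
        split_ifs <;> simp
    -- It suffices to find a conformal relation that vanishes at a point of `F`.
    have reduce : ∀ u : α → ℝ, (∃ z ∈ F, u z ≠ 0) → (∀ i, ∑ z ∈ F, u z * Φ i z = 0) →
        (∀ z ∈ F, (0 < u z → 0 < w z) ∧ (u z < 0 → w z < 0)) → (∃ z ∈ F, u z = 0) →
        ∃ G ⊆ F, ∃ u : α → ℝ, G.card ≤ n + 1 ∧ (∃ z ∈ G, u z ≠ 0) ∧ (∀ z ∉ G, u z = 0) ∧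
          (∀ i, ∑ z ∈ G, u z * Φ i z = 0) ∧
          ∀ z, (0 < u z → 0 < w z) ∧ (u z < 0 → w z < 0) := by
      rintro u ⟨y, hy, huy⟩ hu hconf ⟨z, hz, huz⟩
      obtain ⟨G, hGF, u', hGc, hne, hout, hrel', hconf'⟩ := ih (F.erase z) u
        ⟨y, Finset.mem_erase.2 ⟨fun h => huy (h ▸ huz), hy⟩, huy⟩
        (fun i => by rw [Finset.sum_erase _ (by simp [huz]), hu i])
        (by rw [Finset.card_erase_of_mem hz, hN]; rfl)
      have hG := hGF.trans (Finset.erase_subset _ _)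
      refine ⟨G, hG, u', hGc, hne, hout, hrel', fun x => ?_⟩
      by_cases hx : x ∈ G
      · exact ⟨fun h => (hconf x (hG hx)).1 ((hconf' x).1 h),
          fun h => (hconf x (hG hx)).2 ((hconf' x).2 h)⟩
      · simp [hout x hx]
    by_cases hzero : ∃ z ∈ F, w z = 0
    · exact reduce w hw hrel (fun z _ => ⟨id, id⟩) hzero
    push Not at hzero
    obtain ⟨z₀, hz₀, -⟩ := hw
    obtain ⟨v, ⟨z₁, hz₁, hv₁⟩, hvout, hv⟩ :=
      exists_relation_of_lt_card Φ (F := F.erase z₀)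
        (by rw [Finset.card_erase_of_mem hz₀]; omega)
    have hv₀ : v z₀ = 0 := hvout _ (by simp)
    have hz₁F := Finset.mem_of_mem_erase hz₁
    obtain ⟨v, hv₀, hv₁, hv⟩ : ∃ v : α → ℝ, v z₀ = 0 ∧ 0 < v z₁ * w z₁ ∧
        ∀ i, ∑ z ∈ F, v z * Φ i z = 0 := by
      have hvF : ∀ i, ∑ z ∈ F, v z * Φ i z = 0 := fun i => by
        rw [← hv i, Finset.sum_erase _ (by simp [hv₀])]
      rcases lt_or_gt_of_ne (mul_ne_zero hv₁ (hzero z₁ hz₁F)) with h | h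
      · exact ⟨-v, by simp [hv₀], by simpa using h, fun i => by simpa using hvF i⟩
      · exact ⟨v, hv₀, h, hvF⟩
    obtain ⟨z₂, hz₂, hmin⟩ := (F.filter fun z => 0 < v z * w z).exists_min_image
      (fun z => w z / v z) ⟨z₁, by simp [hz₁F, hv₁]⟩
    rw [Finset.mem_filter] at hz₂
    obtain ⟨hz₂, hvw⟩ := hz₂
    have hv₂ : v z₂ ≠ 0 := fun h => by simp [h] at hvw
    have ht : 0 < w z₂ / v z₂ := by
      rw [show w z₂ / v z₂ = v z₂ * w z₂ / v z₂ ^ 2 by field_simp]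
      positivity
    set t := w z₂ / v z₂ with htdef
    have hsign : ∀ z ∈ F, 0 ≤ (w z - t * v z) * w z := by
      intro z hz
      by_cases h : 0 < v z * w z
      · have h1 := hmin z (by simp [hz, h])
        have hvz : v z ≠ 0 := fun h' => by simp [h'] at h
        have h2 : (w z - t * v z) * w z = (w z / v z - t) * (v z * w z) := by field_simp
        rw [h2]
        exact mul_nonneg (sub_nonneg.2 h1) h.le
      · nlinarith [mul_nonneg ht.le (neg_nonneg.2 (not_lt.1 h)), sq_nonneg (w z)]
    refine reduce (fun z => w z - t * v z) ⟨z₀, hz₀, by simpa [hv₀] using hzero z₀ hz₀⟩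
      (fun i => ?_) (fun z hz => ⟨fun h => ?_, fun h => ?_⟩)
      ⟨z₂, hz₂, by simp only [htdef]; field_simp; simp⟩
    · simp only [sub_mul, Finset.sum_sub_distrib, mul_assoc, ← Finset.mul_sum, hrel i, hv i]
      simp
    · exact lt_of_le_of_ne (nonneg_of_mul_nonneg_right (hsign z hz) h) (hzero z hz).symm
    · have := hsign z hz
      have h3 := hzero z hz
      by_contra h4
      have : 0 < w z := lt_of_le_of_ne (not_lt.1 h4) h3.symm
      nlinarith [mul_pos (neg_pos.2 h) this]

theorem integrable_of_continuousOn_Icc {A B : ℝ} {σ : Measure ℝ} [IsFiniteMeasure σ]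
    (hσ : σ (Icc A B)ᶜ = 0) {f : ℝ → ℝ} (hf : ContinuousOn f (Icc A B)) : Integrable f σ := by
  have h := hf.integrableOn_compact (μ := σ) isCompact_Icc
  rwa [IntegrableOn, Measure.restrict_eq_self_of_ae_mem (s := Icc A B) (mem_ae_iff.2 hσ)] at h

/-- A finite measure on `[A,B]` can be perturbed in the direction of any continuous density. -/
theorem exists_perturbation {A B : ℝ} {σ : Measure ℝ} [IsFiniteMeasure σ]
    (hσ : σ (Icc A B)ᶜ = 0) {h : ℝ → ℝ} (hh : ContinuousOn h (Icc A B)) :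
    ∃ ε > 0, ∃ σ' : Measure ℝ, IsFiniteMeasure σ' ∧ σ' (Icc A B)ᶜ = 0 ∧
      ∀ g : ℝ → ℝ, ContinuousOn g (Icc A B) →
        ∫ x, g x ∂σ' = ∫ x, g x ∂σ + ε * ∫ x, h x * g x ∂σ := by
  obtain ⟨C, hC⟩ := isCompact_Icc.exists_bound_of_continuousOn hh
  set ε : ℝ := (|C| + 1)⁻¹ with hε
  have hε0 : 0 < ε := by positivity
  have hmem : ∀ᵐ x ∂σ, x ∈ Icc A B := mem_ae_iff.2 hσ
  have hpos : ∀ᵐ x ∂σ, 0 ≤ 1 + ε * h x := by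
    filter_upwards [hmem] with x hx
    have h1 : |h x| ≤ |C| + 1 := by
      have := hC x hx
      rw [Real.norm_eq_abs] at this
      linarith [le_abs_self C]
    have h2 : ε * |h x| ≤ 1 := by
      rw [hε, inv_mul_le_iff₀ (by positivity)]
      linarith
    nlinarith [neg_abs_le (h x), mul_le_mul_of_nonneg_left (neg_abs_le (h x)) hε0.le]
  have hint : Integrable (fun x => 1 + ε * h x) σ :=
    integrable_of_continuousOn_Icc hσ (by fun_prop)
  refine ⟨ε, hε0, σ.withDensity fun x => ENNReal.ofReal (1 + ε * h x),
    isFiniteMeasure_withDensity_ofReal hint.2, withDensity_absolutelyContinuous _ _ hσ,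
    fun g hg => ?_⟩
  rw [integral_withDensity_eq_integral_toReal_smul₀ hint.aemeasurable.ennreal_ofReal (by simp),
    ← integral_const_mul, ← integral_add (integrable_of_continuousOn_Icc hσ hg)
      ((integrable_of_continuousOn_Icc hσ (hh.fun_mul hg)).const_mul ε)]
  refine integral_congr_ae ?_
  filter_upwards [hpos] with x hx
  rw [ENNReal.toReal_ofReal hx, smul_eq_mul]
  ring

/-- A maximizer of `∫ Ω dσ` over the feasible set has finite support. -/
theorem exists_finset_of_maximizer {k : ℕ} {A B : ℝ} {Ψ : Fin k → ℝ → ℝ} {Ω : ℝ → ℝ}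
    (hcontΨ : ∀ i, ContinuousOn (Ψ i) (Icc A B)) (hcontΩ : ContinuousOn Ω (Icc A B))
    (hns : IsNonsingularSystem A B (Fin.snoc Ψ Ω : Fin (k + 1) → ℝ → ℝ))
    {c : Fin k → ℝ} {σ : Measure ℝ} (hσ : IsFeasible A B Ψ c σ)
    (hmax : ∀ τ : Measure ℝ, IsFeasible A B Ψ c τ → ∫ x, Ω x ∂τ ≤ ∫ x, Ω x ∂σ) :
    ∃ F : Finset ℝ, (∀ z ∈ F, z ∈ Icc A B) ∧ σ (F : Set ℝ)ᶜ = 0 := by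
  obtain ⟨hfin, hconc, hmom⟩ := hσ
  set Φ : Fin (k + 1) → ℝ → ℝ := Fin.snoc Ψ Ω with hΦ
  have hcont : ∀ i, ContinuousOn (Φ i) (Icc A B) := fun i => by
    refine Fin.lastCases ?_ (fun i => ?_) i
    · simpa [hΦ] using hcontΩ
    · simpa [hΦ] using hcontΨ i
  have hcomb : ∀ a : Fin (k + 1) → ℝ, ContinuousOn (fun x => ∑ i, a i * Φ i x) (Icc A B) :=
    fun a => continuousOn_finsetSum _ fun i _ => (hcont i).const_mul (a i)
  let M : Matrix (Fin (k + 1)) (Fin (k + 1)) ℝ := Matrix.of fun i j => ∫ x, Φ j x * Φ i x ∂σ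
  have hM : ∀ a i, (M.mulVec a) i = ∫ x, (∑ j, a j * Φ j x) * Φ i x ∂σ := by
    intro a i
    simp only [Finset.sum_mul, mul_assoc]
    rw [integral_finsetSum _ fun j _ => (integrable_of_continuousOn_Icc hconc
      ((hcont j).fun_mul (hcont i))).const_mul (a j)]
    simp [M, Matrix.mulVec, dotProduct, integral_const_mul, mul_comm]
  by_cases hdet : M.det = 0
  · obtain ⟨a, ha, hMa⟩ := Matrix.exists_mulVec_eq_zero_iff.2 hdet
    have hsq : ∫ x, (∑ j, a j * Φ j x) * (∑ j, a j * Φ j x) ∂σ = 0 := by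
      have : ∀ x, (∑ j, a j * Φ j x) * (∑ j, a j * Φ j x) =
          ∑ i, a i * ((∑ j, a j * Φ j x) * Φ i x) := fun x => by
        rw [Finset.mul_sum]
        exact Finset.sum_congr rfl fun i _ => by ring
      simp only [this]
      rw [integral_finsetSum _ fun i _ => (integrable_of_continuousOn_Icc hconc
        ((hcomb a).fun_mul (hcont i))).const_mul (a i)]
      simp [integral_const_mul, ← hM, hMa]
    rw [integral_eq_zero_iff_of_nonneg (fun x => mul_self_nonneg _)
      (integrable_of_continuousOn_Icc hconc ((hcomb a).fun_mul (hcomb a)))] at hsq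
    have hfinite := hns.finite_zeros ha
    refine ⟨hfinite.toFinset, fun z hz => ((hfinite.mem_toFinset).1 hz).1, ?_⟩
    rw [hfinite.coe_toFinset]
    refine mem_ae_iff.1 ?_
    filter_upwards [hsq, show ∀ᵐ x ∂σ, x ∈ Icc A B from mem_ae_iff.2 hconc] with x hx hx'
    exact ⟨hx', mul_self_eq_zero.1 hx⟩
  · exfalso
    set e : Fin (k + 1) → ℝ := Pi.single (Fin.last k) 1 with he
    set a := M⁻¹.mulVec e with ha
    have hMa : M.mulVec a = e := by
      rw [ha, Matrix.mulVec_mulVec, Matrix.mul_nonsing_inv _ (isUnit_iff_ne_zero.2 hdet),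
        Matrix.one_mulVec]
    obtain ⟨ε, hε, τ, hτfin, hτ, hint⟩ := exists_perturbation hconc (hcomb a)
    have hval : ∀ i, ∫ x, Φ i x ∂τ = ∫ x, Φ i x ∂σ + ε * e i := fun i => by
      rw [hint _ (hcont i), ← hM, hMa]
    have h1 := hmax τ ⟨hτfin, hτ, fun i => by
      have := hval i.castSucc
      simp only [hΦ, Fin.snoc_castSucc, he] at this
      rw [this, hmom i]
      simp [(Fin.castSucc_lt_last i).ne]⟩
    have h2 := hval (Fin.last k)
    simp only [hΦ, Fin.snoc_last, he, Pi.single_eq_same, mul_one] at h2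
    linarith

/-- The measure with masses `a z` at the points `z` of a finite set. -/
noncomputable def atomicMeasure (F : Finset ℝ) (a : ℝ → ℝ) : Measure ℝ :=
  ∑ z ∈ F, ENNReal.ofReal (a z) • Measure.dirac z

theorem eq_atomicMeasure {σ : Measure ℝ} [IsFiniteMeasure σ] {F : Finset ℝ}
    (hσ : σ (F : Set ℝ)ᶜ = 0) : σ = atomicMeasure F fun z => σ.real {z} := by
  classical
  ext E hE
  have h1 : σ E = σ ((F.filter (· ∈ E) : Finset ℝ) : Set ℝ) := by
    rw [← measure_inter_add_sdiff E F.measurableSet,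
      measure_mono_null (s := E \ F) (fun x hx => hx.2) hσ, add_zero]
    congr 1
    ext x
    simp [and_comm]
  rw [h1, ← sum_measure_singleton, Finset.sum_filter, atomicMeasure, Measure.finsetSum_apply]
  refine Finset.sum_congr rfl fun z _ => ?_
  by_cases hz : z ∈ E <;> simp [hz, hE]

theorem integral_atomicMeasure {F : Finset ℝ} {a : ℝ → ℝ} (ha : ∀ z ∈ F, 0 ≤ a z)
    (f : ℝ → ℝ) : ∫ x, f x ∂(atomicMeasure F a) = ∑ z ∈ F, a z * f z := by
  rw [atomicMeasure, integral_finsetSum_measure fun z _ =>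
    (integrable_dirac (by simp)).smul_measure (by simp)]
  refine Finset.sum_congr rfl fun z hz => ?_
  simp [integral_smul_measure, ENNReal.toReal_ofReal (ha z hz)]

theorem isFeasible_atomicMeasure {k : ℕ} {A B : ℝ} {Ψ : Fin k → ℝ → ℝ} {c : Fin k → ℝ}
    {F : Finset ℝ} (hF : ∀ z ∈ F, z ∈ Icc A B) {a : ℝ → ℝ} (ha : ∀ z ∈ F, 0 ≤ a z)
    (hc : ∀ i, ∑ z ∈ F, a z * Ψ i z = c i) : IsFeasible A B Ψ c (atomicMeasure F a) := by
  refine ⟨⟨?_⟩, ?_, fun i => by rw [integral_atomicMeasure ha, hc i]⟩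
  · simp [atomicMeasure]
  · rw [atomicMeasure, Measure.finsetSum_apply]
    refine Finset.sum_eq_zero fun z hz => ?_
    simp [(hF z hz).1, (hF z hz).2]

/-- If every convex combination of `Ω₁` and `Ω₂` extends `Ψ` to a nonsingular system, then
`∫ Ω₁ dσ` and `∫ Ω₂ dσ` have the same maximizer over the feasible set. -/
theorem maximizer_unique_of_nonsingular {k : ℕ} {A B : ℝ} (hAB : A < B)
    {Ψ : Fin k → ℝ → ℝ} {Ω₁ Ω₂ : ℝ → ℝ}
    (hcontΨ : ∀ i, ContinuousOn (Ψ i) (Icc A B))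
    (hcontΩ₁ : ContinuousOn Ω₁ (Icc A B)) (hcontΩ₂ : ContinuousOn Ω₂ (Icc A B))
    (hns : ∀ a b : ℝ, 0 ≤ a → 0 ≤ b → a + b = 1 → IsNonsingularSystem A B
      (Fin.snoc Ψ (fun y => a * Ω₁ y + b * Ω₂ y) : Fin (k + 1) → ℝ → ℝ))
    {c : Fin k → ℝ} {σ₁ σ₂ : Measure ℝ}
    (h₁ : IsFeasible A B Ψ c σ₁) (h₂ : IsFeasible A B Ψ c σ₂)
    (hmax₁ : ∀ σ : Measure ℝ, IsFeasible A B Ψ c σ → ∫ x, Ω₁ x ∂σ ≤ ∫ x, Ω₁ x ∂σ₁)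
    (hmax₂ : ∀ σ : Measure ℝ, IsFeasible A B Ψ c σ → ∫ x, Ω₂ x ∂σ ≤ ∫ x, Ω₂ x ∂σ₂) :
    σ₁ = σ₂ := by
  classical
  obtain ⟨F₁, hF₁, hs₁⟩ := exists_finset_of_maximizer hcontΨ hcontΩ₁
    (by simpa using hns 1 0 zero_le_one le_rfl (by simp)) h₁ hmax₁
  obtain ⟨F₂, hF₂, hs₂⟩ := exists_finset_of_maximizer hcontΨ hcontΩ₂
    (by simpa using hns 0 1 le_rfl zero_le_one (by simp)) h₂ hmax₂
  have := h₁.1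
  have := h₂.1
  set F := F₁ ∪ F₂ with hFdef
  have hF : ∀ z ∈ F, z ∈ Icc A B := fun z hz =>
    (Finset.mem_union.1 hz).elim (hF₁ z) (hF₂ z)
  set a : ℝ → ℝ := fun z => σ₁.real {z}
  set b : ℝ → ℝ := fun z => σ₂.real {z}
  have ha : ∀ z, 0 ≤ a z := fun z => measureReal_nonneg
  have hb : ∀ z, 0 ≤ b z := fun z => measureReal_nonneg
  have e₁ : σ₁ = atomicMeasure F a := eq_atomicMeasure
    (measure_mono_null (compl_subset_compl.2 (by simp [hFdef])) hs₁)
  have e₂ : σ₂ = atomicMeasure F b := eq_atomicMeasure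
    (measure_mono_null (compl_subset_compl.2 (by simp [hFdef])) hs₂)
  clear_value a b
  subst e₁ e₂
  by_contra hne
  have hca : ∀ i, ∑ z ∈ F, a z * Ψ i z = c i := fun i => by
    rw [← integral_atomicMeasure fun z _ => ha z]
    exact h₁.2.2 i
  have hcb : ∀ i, ∑ z ∈ F, b z * Ψ i z = c i := fun i => by
    rw [← integral_atomicMeasure fun z _ => hb z]
    exact h₂.2.2 i
  have hw : ∃ z ∈ F, a z - b z ≠ 0 := by
    by_contra! h
    exact hne (Finset.sum_congr rfl fun z hz => by rw [sub_eq_zero.1 (h z hz)])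
  obtain ⟨G, hGF, u, hGcard, ⟨z₀, hz₀, hu₀⟩, hout, hrel, hconf⟩ :=
    exists_conformal_relation Ψ F (fun z => a z - b z) hw fun i => by
      simp [sub_mul, hca, hcb]
  have hsum : ∀ H : Finset ℝ, G ⊆ H → ∀ f : ℝ → ℝ,
      ∑ z ∈ G, u z * f z = ∑ z ∈ H, u z * f z := fun H hH f =>
    Finset.sum_subset hH fun z _ hz => by simp [hout z hz]
  obtain ⟨ε, hε, hpos⟩ : ∃ ε > 0, ∀ z ∈ F, 0 ≤ a z - ε * u z ∧ 0 ≤ b z + ε * u z := by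
    have : ∀ᶠ ε in nhdsWithin (0 : ℝ) (Ioi 0),
        ∀ z ∈ F, 0 ≤ a z - ε * u z ∧ 0 ≤ b z + ε * u z := by
      rw [Finset.eventually_all]
      intro z _
      have hA : 0 < a z → ∀ᶠ ε in nhdsWithin (0 : ℝ) (Ioi 0), 0 < a z - ε * u z := fun h =>
        (ContinuousAt.eventually_lt (by fun_prop) (f := fun _ => (0 : ℝ))
          (g := fun ε => a z - ε * u z) (by fun_prop) (by simpa using h)).filter_mono
          nhdsWithin_le_nhds
      have hB : 0 < b z → ∀ᶠ ε in nhdsWithin (0 : ℝ) (Ioi 0), 0 < b z + ε * u z := fun h =>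
        (ContinuousAt.eventually_lt (by fun_prop) (f := fun _ => (0 : ℝ))
          (g := fun ε => b z + ε * u z) (by fun_prop) (by simpa using h)).filter_mono
          nhdsWithin_le_nhds
      rcases lt_trichotomy (u z) 0 with h | h | h
      · have h' := (hconf z).2 h
        filter_upwards [hB (by linarith [ha z]), self_mem_nhdsWithin] with ε h1 h2
        exact ⟨by nlinarith [ha z, mul_pos (mem_Ioi.1 h2) (neg_pos.2 h)], h1.le⟩
      · simp [h, ha z, hb z]
      · have h' := (hconf z).1 h
        filter_upwards [hA (by linarith [hb z]), self_mem_nhdsWithin] with ε h1 h2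
        exact ⟨h1.le, by nlinarith [hb z, mul_pos (mem_Ioi.1 h2) h]⟩
    obtain ⟨ε, h, hε⟩ := (this.and self_mem_nhdsWithin).exists
    exact ⟨ε, hε, h⟩
  have hrelF : ∀ i, ∑ z ∈ F, u z * Ψ i z = 0 := fun i => by rw [← hsum F hGF, hrel i]
  have hΩ₁ : 0 ≤ ∑ z ∈ G, u z * Ω₁ z := by
    have := hmax₁ _ (isFeasible_atomicMeasure hF (fun z hz => (hpos z hz).1) fun i => by
      simp [sub_mul, mul_assoc, ← Finset.mul_sum, hrelF i, hca i])
    rw [integral_atomicMeasure fun z hz => (hpos z hz).1,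
      integral_atomicMeasure fun z _ => ha z] at this
    simp only [sub_mul, Finset.sum_sub_distrib, mul_assoc, ← Finset.mul_sum] at this
    rw [hsum F hGF]
    exact nonneg_of_mul_nonneg_right (by linarith) hε
  have hΩ₂ : ∑ z ∈ G, u z * Ω₂ z ≤ 0 := by
    have := hmax₂ _ (isFeasible_atomicMeasure hF (fun z hz => (hpos z hz).2) fun i => by
      simp [add_mul, Finset.sum_add_distrib, mul_assoc, ← Finset.mul_sum, hrelF i, hcb i])
    rw [integral_atomicMeasure fun z hz => (hpos z hz).2,
      integral_atomicMeasure fun z _ => hb z] at this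
    simp only [add_mul, Finset.sum_add_distrib, mul_assoc, ← Finset.mul_sum] at this
    rw [hsum F hGF]
    by_contra! h
    nlinarith [mul_pos hε h]
  obtain ⟨s, t, hs, ht, hst, hzero⟩ : ∃ s t : ℝ, 0 ≤ s ∧ 0 ≤ t ∧ s + t = 1 ∧
      s * ∑ z ∈ G, u z * Ω₁ z + t * ∑ z ∈ G, u z * Ω₂ z = 0 := by
    obtain ⟨s, t, hs, ht, hst, h⟩ :=
      (segment_eq_uIcc _ _).ge (mem_uIcc_of_ge hΩ₂ hΩ₁)
    exact ⟨s, t, hs, ht, hst, h⟩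
  obtain ⟨H, hGH, hHI, hHcard⟩ := (Icc_infinite hAB).exists_superset_ncard_eq
    (s := (G : Set ℝ)) (fun z hz => hF z (hGF hz)) G.finite_toSet
    (k := k + 1) (by simpa using hGcard)
  have hHfin : H.Finite := finite_of_ncard_ne_zero (by omega)
  lift H to Finset ℝ using hHfin
  rw [Finset.coe_subset] at hGH
  refine hu₀ ((hns s t hs ht hst).eq_zero_of_sum_eq_zero (G := H) (fun z hz => hHI hz)
    (by simpa using hHcard) (fun i => ?_) z₀ (hGH hz₀))
  refine Fin.lastCases ?_ (fun i => ?_) i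
  · rw [← hzero, hsum H hGH, hsum H hGH, Finset.mul_sum, Finset.mul_sum,
      ← Finset.sum_add_distrib]
    refine Finset.sum_congr rfl fun z _ => ?_
    rw [Fin.snoc_last]
    ring
  · rw [← hrel i, hsum H hGH]
    simp

/-- The extremal measures do not depend on the extending function: if both
`{Ψ₀,…,Ψ_{k-1},Ω₁}` and `{Ψ₀,…,Ψ_{k-1},Ω₂}` are Chebyshev systems, a maximizer of
`∫ Ω₁ dσ` over the feasible set coincides with any maximizer of `∫ Ω₂ dσ`, and likewise
for minimizers. -/
theorem principal_representation_independent_of_Omega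
    {k : ℕ} (hk : 0 < k) (A B : ℝ) (hAB : A < B)
    (Ψ : Fin k → ℝ → ℝ) (Ω₁ Ω₂ : ℝ → ℝ)
    (hcontΨ : ∀ i, ContinuousOn (Ψ i) (Set.Icc A B))
    (hcontΩ₁ : ContinuousOn Ω₁ (Set.Icc A B))
    (hcontΩ₂ : ContinuousOn Ω₂ (Set.Icc A B))
    (hCheb : IsChebyshevSystem A B Ψ)
    (hCheb₁ : IsChebyshevSystem A B (Fin.snoc Ψ Ω₁))
    (hCheb₂ : IsChebyshevSystem A B (Fin.snoc Ψ Ω₂))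
    (c : Fin k → ℝ)
    (hS : ∃ σ : Measure ℝ, IsFeasible A B Ψ c σ) :
    (∀ σ₁ σ₂ : Measure ℝ, IsFeasible A B Ψ c σ₁ → IsFeasible A B Ψ c σ₂ →
      (∀ σ : Measure ℝ, IsFeasible A B Ψ c σ → ∫ x, Ω₁ x ∂σ ≤ ∫ x, Ω₁ x ∂σ₁) →
      (∀ σ : Measure ℝ, IsFeasible A B Ψ c σ → ∫ x, Ω₂ x ∂σ ≤ ∫ x, Ω₂ x ∂σ₂) →
      σ₁ = σ₂) ∧
    (∀ σ₁ σ₂ : Measure ℝ, IsFeasible A B Ψ c σ₁ → IsFeasible A B Ψ c σ₂ →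
      (∀ σ : Measure ℝ, IsFeasible A B Ψ c σ → ∫ x, Ω₁ x ∂σ₁ ≤ ∫ x, Ω₁ x ∂σ) →
      (∀ σ : Measure ℝ, IsFeasible A B Ψ c σ → ∫ x, Ω₂ x ∂σ₂ ≤ ∫ x, Ω₂ x ∂σ) →
      σ₁ = σ₂) := by
  have hdet : ∀ a b : ℝ, 0 ≤ a → 0 ≤ b → a + b = 1 → ∀ x : Fin (k + 1) → ℝ, StrictMono x →
      (∀ j, x j ∈ Icc A B) →
      0 < a * (Matrix.of fun i j => (Fin.snoc Ψ Ω₁ : Fin (k + 1) → ℝ → ℝ) i (x j)).det +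
        b * (Matrix.of fun i j => (Fin.snoc Ψ Ω₂ : Fin (k + 1) → ℝ → ℝ) i (x j)).det := by
    intro a b ha hb hab x hx hxI
    exact (convex_Ioi (0 : ℝ)) (hCheb₁ x hx hxI) (hCheb₂ x hx hxI) ha hb hab
  refine ⟨fun σ₁ σ₂ h₁ h₂ hmax₁ hmax₂ => ?_, fun σ₁ σ₂ h₁ h₂ hmin₁ hmin₂ => ?_⟩
  · refine maximizer_unique_of_nonsingular hAB hcontΨ hcontΩ₁ hcontΩ₂
      (fun a b ha hb hab x hx hxI => ?_) h₁ h₂ hmax₁ hmax₂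
    rw [det_snoc_linear_comb]
    exact (hdet a b ha hb hab x hx hxI).ne'
  · refine maximizer_unique_of_nonsingular (Ω₁ := fun y => -Ω₁ y) (Ω₂ := fun y => -Ω₂ y)
      hAB hcontΨ hcontΩ₁.neg hcontΩ₂.neg (fun a b ha hb hab x hx hxI => ?_) h₁ h₂
      (fun σ hσ => ?_) (fun σ hσ => ?_)
    · simp only [mul_neg, ← neg_mul]
      rw [det_snoc_linear_comb]
      have := hdet a b ha hb hab x hx hxI
      linarith
    · simpa only [integral_neg, neg_le_neg_iff] using hmin₁ σ hσ
    · simpa only [integral_neg, neg_le_neg_iff] using hmin₂ σ hσ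
end
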